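/- (Contraction estimate (54) for the stationary Fokker–Planck operator.) Let δ > Ū, let μ₀ be a Borel probability measure on Ω, and let θ : Ω → ℝ be Borel measurable with 0 ≤ θ(x) ≤ Ū for all x ∈ Ω. For a Borel probability measure m on Ω, let F(m) be the Borel measure on Ω given by F(m)(A) = ∫_A δ / (δ − θ(x) + ∫_Ω θ dm) μ₀(dx) for Borel sets A ⊆ Ω. Then for any two Borel probability measures m₁, m₂ on Ω, TV(F(m₁), F(m₂)) ≤ (δ Ū / (δ − Ū)²) · TV(m₁, m₂). -/

import Mathlib

open MeasureTheory

/-- The action space `Ω = [0,1] ⊆ ℝ` with its Borel σ-algebra. -/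
abbrev Ω : Type := Set.Icc (0:ℝ) 1

/-- Total variation distance between two (finite) Borel measures on `Ω`:
the total mass of the total variation of `μ − ν`, expressed via the Jordan
decomposition as `(μ − ν)(Ω) + (ν − μ)(Ω)` (truncated measure subtraction). -/
noncomputable def TV (μ ν : Measure Ω) : ℝ :=
  ((μ - ν) Set.univ + (ν - μ) Set.univ).toReal

theorem TV_comm_aux (μ ν : Measure Ω) : TV μ ν = TV ν μ := by
  unfold TV; rw [add_comm]

theorem integral_le_aux
    (Ubar : ℝ) (hUbar : 0 < Ubar)
    (θ : Ω → ℝ) (hθm : Measurable θ) (hθ : ∀ x, 0 ≤ θ x ∧ θ x ≤ Ubar)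
    (m₁ m₂ : Measure Ω) [IsProbabilityMeasure m₁] [IsProbabilityMeasure m₂] :
    (∫ z, θ z ∂m₂) - ∫ z, θ z ∂m₁ ≤ Ubar * TV m₁ m₂ := by
  have hint : ∀ (m : Measure Ω) [IsFiniteMeasure m], Integrable θ m := fun m _ =>
    Integrable.of_bound hθm.aestronglyMeasurable Ubar
      (Filter.Eventually.of_forall fun x => by
        rw [Real.norm_eq_abs, abs_of_nonneg (hθ x).1]; exact (hθ x).2)
  have hle : m₂ ≤ (m₂ - m₁) + m₁ := Measure.sub_le_iff_le_add.1 le_rfl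
  have h1 : ∫ z, θ z ∂m₂ ≤ ∫ z, θ z ∂((m₂ - m₁) + m₁) :=
    integral_mono_measure hle (Filter.Eventually.of_forall fun x => (hθ x).1) (hint _)
  rw [integral_add_measure (hint _) (hint _)] at h1
  have h2 : ∫ z, θ z ∂(m₂ - m₁) ≤ ∫ _, Ubar ∂(m₂ - m₁) :=
    integral_mono (hint _) (integrable_const _) fun x => (hθ x).2
  rw [integral_const, smul_eq_mul] at h2
  have h3 : (m₂ - m₁).real Set.univ ≤ TV m₁ m₂ := by
    unfold TV Measure.real
    exact ENNReal.toReal_mono (by finiteness) le_add_self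
  nlinarith [mul_le_mul_of_nonneg_left h3 hUbar.le]

theorem core_aux
    (Ubar : ℝ) (hUbar : 0 < Ubar)
    (δ : ℝ) (hδ : Ubar < δ)
    (μ0 : Measure Ω) [IsProbabilityMeasure μ0]
    (θ : Ω → ℝ) (hθm : Measurable θ) (hθ : ∀ x, 0 ≤ θ x ∧ θ x ≤ Ubar)
    (c₁ c₂ : ℝ) (hc₁ : 0 ≤ c₁) (hc : c₁ ≤ c₂)
    (F₁ F₂ : Measure Ω)
    (hF₁ : ∀ A : Set Ω, MeasurableSet A →
      F₁ A = ENNReal.ofReal (∫ x in A, δ / (δ - θ x + c₁) ∂μ0))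
    (hF₂ : ∀ A : Set Ω, MeasurableSet A →
      F₂ A = ENNReal.ofReal (∫ x in A, δ / (δ - θ x + c₂) ∂μ0)) :
    TV F₁ F₂ ≤ δ / (δ - Ubar) ^ 2 * (c₂ - c₁) := by
  have hd : 0 < δ - Ubar := by linarith
  have hδ0 : 0 < δ := by linarith
  have hpos : ∀ c, 0 ≤ c → ∀ x, δ - Ubar ≤ δ - θ x + c := fun c h x => by
    linarith [(hθ x).2]
  have hnn : ∀ c, 0 ≤ c → ∀ x, 0 ≤ δ / (δ - θ x + c) := fun c h x =>
    div_nonneg hδ0.le (hd.le.trans (hpos c h x))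
  have hint : ∀ c, 0 ≤ c → Integrable (fun x => δ / (δ - θ x + c)) μ0 := fun c h =>
    Integrable.of_bound (Measurable.aestronglyMeasurable (by fun_prop)) (δ / (δ - Ubar))
      (Filter.Eventually.of_forall fun x => by
        rw [Real.norm_eq_abs, abs_of_nonneg (hnn c h x)]
        exact div_le_div_of_nonneg_left hδ0.le hd (hpos c h x))
  have hc₂ : 0 ≤ c₂ := hc₁.trans hc
  haveI : IsFiniteMeasure F₂ := ⟨by rw [hF₂ _ MeasurableSet.univ]; exact ENNReal.ofReal_lt_top⟩
  have hle : F₂ ≤ F₁ := by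
    rw [Measure.le_iff]
    intro A hA
    rw [hF₁ A hA, hF₂ A hA]
    refine ENNReal.ofReal_le_ofReal (integral_mono (hint _ hc₂).integrableOn
      (hint _ hc₁).integrableOn fun x => ?_)
    exact div_le_div_of_nonneg_left hδ0.le (hd.trans_le (hpos _ hc₁ x)) (by linarith)
  have hI : ∫ x, δ / (δ - θ x + c₁) ∂μ0 - ∫ x, δ / (δ - θ x + c₂) ∂μ0
      ≤ δ / (δ - Ubar) ^ 2 * (c₂ - c₁) := by
    rw [← integral_sub (hint _ hc₁) (hint _ hc₂)]
    have : ∫ x, (δ / (δ - θ x + c₁) - δ / (δ - θ x + c₂)) ∂μ0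
        ≤ ∫ _, δ / (δ - Ubar) ^ 2 * (c₂ - c₁) ∂μ0 := by
      refine integral_mono ((hint _ hc₁).sub (hint _ hc₂)) (integrable_const _) fun x => ?_
      have p1 := hpos _ hc₁ x
      have p2 := hpos _ hc₂ x
      have q1 := hd.trans_le p1
      have q2 := hd.trans_le p2
      have e : δ / (δ - θ x + c₁) - δ / (δ - θ x + c₂)
          = (δ * (c₂ - c₁)) / ((δ - θ x + c₁) * (δ - θ x + c₂)) := by
        field_simp; ring
      show δ / (δ - θ x + c₁) - δ / (δ - θ x + c₂) ≤ _
      rw [e, div_mul_eq_mul_div]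
      refine div_le_div_of_nonneg_left (mul_nonneg hδ0.le (by linarith)) (by positivity) ?_
      rw [sq]
      exact mul_le_mul p1 p2 hd.le q1.le
    simpa using this
  unfold TV
  rw [Measure.sub_eq_zero_of_le hle, Measure.sub_apply MeasurableSet.univ hle,
    hF₁ _ MeasurableSet.univ, hF₂ _ MeasurableSet.univ, Measure.restrict_univ,
    ← ENNReal.ofReal_sub _ (integral_nonneg (hnn _ hc₂))]
  simp only [Measure.coe_zero, Pi.zero_apply, add_zero]
  rw [ENNReal.toReal_ofReal']
  refine max_le hI ?_
  have : 0 ≤ c₂ - c₁ := by linarith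
  positivity

/-- **Contraction estimate (54) for the stationary Fokker–Planck operator.**
Here `F₁ = F(m₁)` and `F₂ = F(m₂)` are the measures given by
`F(m)(A) = ∫_A δ / (δ − θ(x) + ∫ θ dm) μ₀(dx)`. -/
theorem stmt5
    (Ubar : ℝ) (hUbar : 0 < Ubar)
    (δ : ℝ) (hδ : Ubar < δ)
    (μ0 : Measure Ω) [IsProbabilityMeasure μ0]
    (θ : Ω → ℝ) (hθm : Measurable θ) (hθ : ∀ x, 0 ≤ θ x ∧ θ x ≤ Ubar)
    (m₁ m₂ : Measure Ω) [IsProbabilityMeasure m₁] [IsProbabilityMeasure m₂]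
    (F₁ F₂ : Measure Ω)
    (hF₁ : ∀ A : Set Ω, MeasurableSet A →
      F₁ A = ENNReal.ofReal (∫ x in A, δ / (δ - θ x + ∫ z, θ z ∂m₁) ∂μ0))
    (hF₂ : ∀ A : Set Ω, MeasurableSet A →
      F₂ A = ENNReal.ofReal (∫ x in A, δ / (δ - θ x + ∫ z, θ z ∂m₂) ∂μ0)) :
    TV F₁ F₂ ≤ (δ * Ubar / (δ - Ubar) ^ 2) * TV m₁ m₂ := by
  have hn : ∀ m : Measure Ω, 0 ≤ ∫ z, θ z ∂m := fun m => integral_nonneg fun x => (hθ x).1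
  have hK : 0 ≤ δ / (δ - Ubar) ^ 2 := div_nonneg (by linarith) (sq_nonneg _)
  have e : δ * Ubar / (δ - Ubar) ^ 2 * TV m₁ m₂
      = δ / (δ - Ubar) ^ 2 * (Ubar * TV m₁ m₂) := by ring
  rw [e]
  rcases le_total (∫ z, θ z ∂m₁) (∫ z, θ z ∂m₂) with h | h
  · exact (core_aux Ubar hUbar δ hδ μ0 θ hθm hθ _ _ (hn _) h F₁ F₂ hF₁ hF₂).trans
      (mul_le_mul_of_nonneg_left (integral_le_aux Ubar hUbar θ hθm hθ m₁ m₂) hK)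
  · rw [TV_comm_aux F₁, TV_comm_aux m₁]
    exact (core_aux Ubar hUbar δ hδ μ0 θ hθm hθ _ _ (hn _) h F₂ F₁ hF₂ hF₁).trans
      (mul_le_mul_of_nonneg_left (integral_le_aux Ubar hUbar θ hθm hθ m₂ m₁) hK)
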